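/- Energy-momentum conservation identity for the form factors: for every even N ≥ 2 and every admissible tuple X = (x_1,…,x_N), S_{−1}(X) · ( J^{(2)}_{N,−1/2}(X) + (i/π) · S_1(X)² · (d/da J_{N,a}(X))|_{a=−1/2} ) = (i / sin πp) · S_1(X) · J̃_N(X), where J^{(2)}_{N,−1/2} is the J function of the partition (2) at a = −1/2 (i.e., with e^{iπa} = −i), and J̃_N is the exponential-field J function at a = p − 1/2 (i.e., with e^{iπa} = −iω). -/

import Mathlib

open Finset Filter Complex

/-- The function `f(x) = (x+ω)(x−ω⁻¹)/(x²−1)`. -/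
noncomputable def ff (ω x : ℂ) : ℂ := (x + ω) * (x - ω⁻¹) / (x ^ 2 - 1)

/-- The power sum `S_m` (with `m ∈ ℤ`) of the entries `X i`, `i ∈ I`. -/
noncomputable def pS (m : ℤ) {N : ℕ} (X : Fin N → ℂ) (I : Finset (Fin N)) : ℂ :=
  ∑ i ∈ I, X i ^ m

/-- The polynomial `P^h(X_-|X_+) = ∏_{m=1}^s (S_m(X_-) − (−1)^m S_m(X_+))^{k_m}` of the
partition `h` with multiplicities `k` (with `k m` parts equal to `m`, `1 ≤ m ≤ s`),
evaluated on the entries of `X` indexed by `Im` and `Ip`. -/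
noncomputable def Ph (k : ℕ → ℕ) (s : ℕ) {N : ℕ} (X : Fin N → ℂ)
    (Im Ip : Finset (Fin N)) : ℂ :=
  ∏ m ∈ Finset.Icc 1 s, (pS (m : ℤ) X Im - (-1 : ℂ) ^ m * pS (m : ℤ) X Ip) ^ k m

/-- A tuple is admissible if all entries are nonzero and `x_i ≠ ±x_j` for `i ≠ j`. -/
def Admissible {N : ℕ} (X : Fin N → ℂ) : Prop :=
  (∀ i, X i ≠ 0) ∧ ∀ i j, i ≠ j → X i ≠ X j ∧ X i ≠ -X j

/-- The phase factor `e^{iπa(#I_- − #I_+)}` where `#I_- = c`, `#I_+ = N − c`. -/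
noncomputable def phase (a : ℂ) (N c : ℕ) : ℂ :=
  Complex.exp (Complex.I * (Real.pi : ℂ) * a * (2 * (c : ℂ) - (N : ℂ)))

/-- The descendant function
`J^h_{N,a}(X) = Σ_{I_- ⊔ I_+} e^{iπa(#I_- − #I_+)} P^h(X_-|X_+) ∏_{i∈I_-, j∈I_+} f(x_i/x_j)`. -/
noncomputable def J (ω : ℂ) (k : ℕ → ℕ) (s : ℕ) (a : ℂ) {N : ℕ} (X : Fin N → ℂ) : ℂ :=
  ∑ I : Finset (Fin N),
    phase a N I.card * Ph k s X I Iᶜ * ∏ i ∈ I, ∏ j ∈ Iᶜ, ff ω (X i / X j)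

/-- The exponential-field function `J_{N,a}(X)` (the case `P^h = 1`). -/
noncomputable def Jexp (ω a : ℂ) {N : ℕ} (X : Fin N → ℂ) : ℂ :=
  ∑ I : Finset (Fin N),
    phase a N I.card * ∏ i ∈ I, ∏ j ∈ Iᶜ, ff ω (X i / X j)

/-- The function `J̃_N(X)`: the exponential-field `J` function at the parameter value
`a = p − 1/2`, i.e. with `e^{iπa}` replaced by `−iω`. -/
noncomputable def Jtilde (ω : ℂ) {N : ℕ} (X : Fin N → ℂ) : ℂ :=
  ∑ I : Finset (Fin N),
    (-(Complex.I * ω)) ^ (2 * (I.card : ℤ) - (N : ℤ)) *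
      ∏ i ∈ I, ∏ j ∈ Iᶜ, ff ω (X i / X j)

/-- Multiplicities of the partition `(2)`. -/
def k2 : ℕ → ℕ := fun m => if m = 2 then 1 else 0

open Polynomial in
/-- The product `∏_{i ∈ T} (1 + a_i u - y_i² u²)` as a polynomial in `u`. -/
noncomputable def quadProd {ι : Type*} (y a : ι → ℂ) (T : Finset ι) : Polynomial ℂ :=
  ∏ i ∈ T, (1 + C (a i) * X - C (y i ^ 2) * X ^ 2)

/-- The value of `f(x/y)` written through `s = ω - ω⁻¹`. -/
noncomputable def pairFactor (s x y : ℂ) : ℂ := (x ^ 2 + s * x * y - y ^ 2) / (x ^ 2 - y ^ 2)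

/-- The signed product `(-1)^#I ∏_{i ∈ I, j ∈ T \ I} f(y_i/y_j)`. -/
noncomputable def signedProd {ι : Type*} [DecidableEq ι] (s : ℂ) (y : ι → ℂ)
    (T I : Finset ι) : ℂ :=
  (-1) ^ #I * ∏ i ∈ I, ∏ j ∈ T \ I, pairFactor s (y i) (y j)

lemma eval_quadProd {ι : Type*} (y a : ι → ℂ) (T : Finset ι) (u : ℂ) :
    (quadProd y a T).eval u = ∏ i ∈ T, (1 + a i * u - y i ^ 2 * u ^ 2) := by
  simp [quadProd, Polynomial.eval_prod]

lemma natDegree_quadProd_le {ι : Type*} (y a : ι → ℂ) (T : Finset ι) :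
    (quadProd y a T).natDegree ≤ 2 * #T := by
  rw [quadProd, mul_comm, ← smul_eq_mul, ← Finset.sum_const]
  refine (Polynomial.natDegree_prod_le _ _).trans (Finset.sum_le_sum fun i _ => ?_)
  compute_degree

lemma coeff_quadProd_top {ι : Type*} (y a : ι → ℂ) (T : Finset ι) :
    (quadProd y a T).coeff (2 * #T) = ∏ i ∈ T, -(y i ^ 2) := by
  rw [quadProd, mul_comm, Polynomial.coeff_prod_of_natDegree_le]
  · refine Finset.prod_congr rfl fun i _ => ?_
    simp [-map_pow, Polynomial.coeff_one]
  · intro i _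
    compute_degree

lemma coeff_zero_quadProd {ι : Type*} (y a : ι → ℂ) (T : Finset ι) : (quadProd y a T).coeff 0 = 1 := by
  rw [Polynomial.coeff_zero_eq_eval_zero, eval_quadProd]
  simp

lemma coeff_one_quadProd {ι : Type*} (y a : ι → ℂ) (T : Finset ι) :
    (quadProd y a T).coeff 1 = ∑ i ∈ T, a i := by
  induction T using Finset.cons_induction with
  | empty => simp [quadProd, Polynomial.coeff_one]
  | cons k T hk ih =>
    have h := coeff_zero_quadProd y a T
    rw [quadProd, Finset.prod_cons hk, ← quadProd, Polynomial.mul_coeff_one, h, ih,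
      Finset.sum_cons hk]
    simp [-map_pow, Polynomial.coeff_one, Polynomial.coeff_X_pow]
    ring

lemma two_mul_coeff_two_quadProd {ι : Type*} (y a : ι → ℂ) (T : Finset ι) :
    2 * (quadProd y a T).coeff 2 = (∑ i ∈ T, a i) ^ 2 - ∑ i ∈ T, (a i ^ 2 + 2 * y i ^ 2) := by
  induction T using Finset.cons_induction with
  | empty => simp [quadProd, Polynomial.coeff_one]
  | cons k T hk ih =>
    have h := coeff_zero_quadProd y a T
    have h1 := coeff_one_quadProd y a T
    rw [quadProd, Finset.prod_cons hk, ← quadProd, Polynomial.coeff_mul,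
      Finset.Nat.sum_antidiagonal_eq_sum_range_succ_mk]
    simp only [Finset.sum_range_succ, Finset.sum_range_zero, Finset.sum_cons hk]
    norm_num [-map_pow, h, h1, Polynomial.coeff_one, Polynomial.coeff_X, Polynomial.coeff_X_pow]
    linear_combination ih

lemma pairFactor_mul_left {s x z u : ℂ} (hu : z * u = 1) (h : x ^ 2 ≠ z ^ 2) :
    pairFactor s x z * (1 - x ^ 2 * u ^ 2) = 1 - s * x * u - x ^ 2 * u ^ 2 := by
  have hz : z ≠ 0 := left_ne_zero_of_mul_eq_one hu
  obtain rfl : u = z⁻¹ := eq_inv_of_mul_eq_one_right hu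
  have := sub_ne_zero.2 h
  rw [pairFactor]
  field_simp
  ring

lemma pairFactor_mul_right {s x z u : ℂ} (hu : z * u = 1) (h : z ^ 2 ≠ x ^ 2) :
    pairFactor s z x * (1 - x ^ 2 * u ^ 2) = 1 + s * x * u - x ^ 2 * u ^ 2 := by
  have hz : z ≠ 0 := left_ne_zero_of_mul_eq_one hu
  obtain rfl : u = z⁻¹ := eq_inv_of_mul_eq_one_right hu
  have := sub_ne_zero.2 h
  rw [pairFactor]
  field_simp

lemma prod_numerator_out {ι : Type*} {s : ℂ} {y : ι → ℂ}
    (hinj : ∀ i j, i ≠ j → y i ^ 2 ≠ y j ^ 2) {V : Finset ι} {a : ι}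
    (ha : a ∉ V) (h0 : y a ≠ 0) :
    ∏ i ∈ V, (1 - s * y i * (y a)⁻¹ - y i ^ 2 * (y a)⁻¹ ^ 2)
      = (∏ i ∈ V, pairFactor s (y i) (y a)) * ∏ i ∈ V, (1 - y i ^ 2 * (y a)⁻¹ ^ 2) := by
  rw [← Finset.prod_mul_distrib]
  exact Finset.prod_congr rfl fun i hi => (pairFactor_mul_left (mul_inv_cancel₀ h0)
    (hinj _ _ fun h => ha (h ▸ hi))).symm

lemma prod_numerator_in {ι : Type*} {s : ℂ} {y : ι → ℂ}
    (hinj : ∀ i j, i ≠ j → y i ^ 2 ≠ y j ^ 2) {V : Finset ι} {a : ι}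
    (ha : a ∉ V) (h0 : y a ≠ 0) :
    ∏ i ∈ V, (1 + s * y i * (y a)⁻¹ - y i ^ 2 * (y a)⁻¹ ^ 2)
      = (∏ i ∈ V, pairFactor s (y a) (y i)) * ∏ i ∈ V, (1 - y i ^ 2 * (y a)⁻¹ ^ 2) := by
  rw [← Finset.prod_mul_distrib]
  exact Finset.prod_congr rfl fun i hi => (pairFactor_mul_right (mul_inv_cancel₀ h0)
    (hinj _ _ fun h => ha (h ▸ hi))).symm

section PowersetSums

variable {ι : Type*} [DecidableEq ι] {s : ℂ} {y : ι → ℂ}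

lemma signedProd_insert_right {T I : Finset ι} {a : ι} (ha : a ∉ T) (hI : I ⊆ T) :
    signedProd s y (insert a T) I
      = signedProd s y T I * ∏ i ∈ I, pairFactor s (y i) (y a) := by
  have haI : a ∉ I := fun h => ha (hI h)
  have h : insert a T \ I = insert a (T \ I) := Finset.insert_sdiff_of_notMem _ haI
  have h' : a ∉ T \ I := fun h => ha (Finset.mem_sdiff.1 h).1
  simp only [signedProd, h, Finset.prod_insert h', Finset.prod_mul_distrib]
  ring

lemma signedProd_insert_left {T I : Finset ι} {a : ι} (ha : a ∉ T) (hI : I ⊆ T) :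
    signedProd s y (insert a T) (insert a I)
      = -(signedProd s y T I * ∏ j ∈ T \ I, pairFactor s (y a) (y j)) := by
  have haI : a ∉ I := fun h => ha (hI h)
  have h : insert a T \ insert a I = T \ I := by
    ext x
    simp only [Finset.mem_sdiff, Finset.mem_insert]
    constructor
    · rintro ⟨rfl | h1, h2⟩ <;> tauto
    · rintro ⟨h1, h2⟩
      refine ⟨Or.inr h1, ?_⟩
      rintro (rfl | h3)
      exacts [ha h1, h2 h3]
  simp only [signedProd, h, Finset.prod_insert haI, Finset.card_insert_of_notMem haI]
  ring

lemma sum_signedProd_insert {T : Finset ι} {a : ι} (ha : a ∉ T) (w : Finset ι → ℂ) :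
    ∑ I ∈ (insert a T).powerset, signedProd s y (insert a T) I * w I
      = ∑ I ∈ T.powerset, signedProd s y T I *
          (w I * ∏ i ∈ I, pairFactor s (y i) (y a)
            - w (insert a I) * ∏ j ∈ T \ I, pairFactor s (y a) (y j)) := by
  rw [Finset.sum_powerset_insert ha, ← Finset.sum_add_distrib]
  refine Finset.sum_congr rfl fun I hI => ?_
  have hI := Finset.mem_powerset.1 hI
  rw [signedProd_insert_right ha hI, signedProd_insert_left ha hI]
  ring

/-- Numerator of `∏_{i ∈ I} f(y_i u)` over the common denominator `∏_{i ∈ T} (1 - y_i² u²)`. -/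
noncomputable def numOut (s : ℂ) (y : ι → ℂ) (T I : Finset ι) : Polynomial ℂ :=
  quadProd y (fun i => if i ∈ I then -(s * y i) else 0) T

/-- Numerator of `∏_{j ∈ T \ I} f((y_j u)⁻¹)` over the common denominator
`∏_{i ∈ T} (1 - y_i² u²)`. -/
noncomputable def numIn (s : ℂ) (y : ι → ℂ) (T I : Finset ι) : Polynomial ℂ :=
  quadProd y (fun i => if i ∈ I then 0 else s * y i) T

lemma eval_numOut {T I : Finset ι} (hI : I ⊆ T) (u : ℂ) :
    (numOut s y T I).eval u = (∏ i ∈ I, (1 - s * y i * u - y i ^ 2 * u ^ 2)) *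
      ∏ j ∈ T \ I, (1 - y j ^ 2 * u ^ 2) := by
  rw [numOut, eval_quadProd, ← Finset.prod_sdiff hI, mul_comm]
  congr 1
  · exact Finset.prod_congr rfl fun i hi => by rw [if_pos hi]; ring
  · exact Finset.prod_congr rfl fun i hi => by rw [if_neg (Finset.mem_sdiff.1 hi).2]; ring

lemma eval_numIn {T I : Finset ι} (hI : I ⊆ T) (u : ℂ) :
    (numIn s y T I).eval u = (∏ i ∈ I, (1 - y i ^ 2 * u ^ 2)) *
      ∏ j ∈ T \ I, (1 + s * y j * u - y j ^ 2 * u ^ 2) := by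
  rw [numIn, eval_quadProd, ← Finset.prod_sdiff hI, mul_comm]
  congr 1
  · exact Finset.prod_congr rfl fun i hi => by rw [if_pos hi]; ring
  · exact Finset.prod_congr rfl fun i hi => by rw [if_neg (Finset.mem_sdiff.1 hi).2]

/-- Clearing denominators in a sum over subsets of `insert a T`. -/
lemma prod_mul_sum_signedProd_insert (hinj : ∀ i j, i ≠ j → y i ^ 2 ≠ y j ^ 2)
    {T : Finset ι} {a : ι} (ha : a ∉ T) (h0 : y a ≠ 0) (w : Finset ι → ℂ) :
    (∏ i ∈ T, (1 - y i ^ 2 * (y a)⁻¹ ^ 2)) *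
      ∑ I ∈ (insert a T).powerset, signedProd s y (insert a T) I * w I
      = ∑ I ∈ T.powerset, signedProd s y T I *
          (w I * (numOut s y T I).eval (y a)⁻¹
            - w (insert a I) * (numIn s y T I).eval (y a)⁻¹) := by
  rw [sum_signedProd_insert ha, Finset.mul_sum]
  refine Finset.sum_congr rfl fun I hI => ?_
  have hI := Finset.mem_powerset.1 hI
  have haI : a ∉ I := fun h => ha (hI h)
  have h1 := prod_numerator_out (s := s) hinj haI h0
  have h2 := prod_numerator_in (s := s) hinj
    (fun h => ha (Finset.mem_sdiff.1 h).1 : a ∉ T \ I) h0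
  rw [eval_numOut hI, eval_numIn hI, h1, h2, ← Finset.prod_sdiff hI]
  ring

/-- Vanishing at `u = y_k⁻¹` for weights symmetric under exchanging the new point with `y_k`. -/
lemma eval_inv_eq_zero (hinj : ∀ i j, i ≠ j → y i ^ 2 ≠ y j ^ 2)
    {T : Finset ι} {k : ι} (hk : k ∉ T) (h0 : y k ≠ 0)
    (w₀ w₁ : Finset ι → ℂ) (hw : ∀ I ⊆ T, w₀ (insert k I) = w₁ I) :
    ∑ I ∈ (insert k T).powerset, signedProd s y (insert k T) I *
      (w₀ I * (numOut s y (insert k T) I).eval (y k)⁻¹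
        - w₁ I * (numIn s y (insert k T) I).eval (y k)⁻¹) = 0 := by
  have hu : y k * (y k)⁻¹ = 1 := mul_inv_cancel₀ h0
  have hu2 : y k ^ 2 * (y k)⁻¹ ^ 2 = 1 := by rw [← mul_pow, hu, one_pow]
  have hne : ∀ i ∈ T, i ≠ k := fun i hi h => hk (h ▸ hi)
  rw [sum_signedProd_insert hk]
  refine Finset.sum_eq_zero fun I hI => ?_
  have hI := Finset.mem_powerset.1 hI
  have hkI : k ∉ I := fun h => hk (hI h)
  have e1 : (numOut s y (insert k T) I).eval (y k)⁻¹ = 0 := by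
    rw [numOut, eval_quadProd, Finset.prod_insert hk, if_neg hkI, hu2]
    ring
  have e2 : (numIn s y (insert k T) (insert k I)).eval (y k)⁻¹ = 0 := by
    rw [numIn, eval_quadProd, Finset.prod_insert hk, if_pos (Finset.mem_insert_self _ _), hu2]
    ring
  have e3 : (numIn s y (insert k T) I).eval (y k)⁻¹ = s * (numIn s y T I).eval (y k)⁻¹ := by
    rw [numIn, eval_quadProd, Finset.prod_insert hk, if_neg hkI, hu2, mul_assoc s, hu, numIn,
      eval_quadProd]
    ring
  have e4 : (numOut s y (insert k T) (insert k I)).eval (y k)⁻¹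
      = -s * (numOut s y T I).eval (y k)⁻¹ := by
    rw [numOut, eval_quadProd, Finset.prod_insert hk, if_pos (Finset.mem_insert_self _ _), hu2,
      neg_mul, mul_assoc s, hu, numOut, eval_quadProd]
    have : ∀ i ∈ T, (i ∈ insert k I ↔ i ∈ I) := fun i hi => by simp [hne i hi]
    rw [Finset.prod_congr rfl fun i hi => by rw [if_congr (this i hi) rfl rfl]]
    ring
  have h1 := prod_numerator_out (s := s) hinj hkI h0
  have h2 := prod_numerator_in (s := s) hinj
    (fun h => hk (Finset.mem_sdiff.1 h).1 : k ∉ T \ I) h0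
  rw [e1, e2, e3, e4, eval_numOut hI, eval_numIn hI, hw I hI, h1, h2]
  ring

/-- At `u = -y_k⁻¹` the sum reduces to sums over subsets of the remaining points. -/
lemma eval_neg_inv (hinj : ∀ i j, i ≠ j → y i ^ 2 ≠ y j ^ 2)
    {T : Finset ι} {k : ι} (hk : k ∉ T) (h0 : y k ≠ 0)
    (w₀ w₁ : Finset ι → ℂ) :
    ∑ I ∈ (insert k T).powerset, signedProd s y (insert k T) I *
      (w₀ I * (numOut s y (insert k T) I).eval (-(y k)⁻¹)
        - w₁ I * (numIn s y (insert k T) I).eval (-(y k)⁻¹))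
      = s * ((∏ i ∈ T, (1 - s * y i * (y k)⁻¹ - y i ^ 2 * (y k)⁻¹ ^ 2)) *
            ∑ I ∈ T.powerset, signedProd s y T I * w₁ I
          - (∏ i ∈ T, (1 + s * y i * (y k)⁻¹ - y i ^ 2 * (y k)⁻¹ ^ 2)) *
            ∑ I ∈ T.powerset, signedProd s y T I * w₀ (insert k I)) := by
  have hu : y k * (y k)⁻¹ = 1 := mul_inv_cancel₀ h0
  have hu2 : y k ^ 2 * (-(y k)⁻¹) ^ 2 = 1 := by rw [neg_sq, ← mul_pow, hu, one_pow]
  have hne : ∀ i ∈ T, i ≠ k := fun i hi h => hk (h ▸ hi)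
  rw [sum_signedProd_insert hk, Finset.mul_sum, Finset.mul_sum, ← Finset.sum_sub_distrib,
    Finset.mul_sum]
  refine Finset.sum_congr rfl fun I hI => ?_
  have hI := Finset.mem_powerset.1 hI
  have hkI : k ∉ I := fun h => hk (hI h)
  have e1 : (numOut s y (insert k T) I).eval (-(y k)⁻¹) = 0 := by
    rw [numOut, eval_quadProd, Finset.prod_insert hk, if_neg hkI, hu2]
    ring
  have e2 : (numIn s y (insert k T) (insert k I)).eval (-(y k)⁻¹) = 0 := by
    rw [numIn, eval_quadProd, Finset.prod_insert hk, if_pos (Finset.mem_insert_self _ _), hu2]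
    ring
  have e3 : (numIn s y (insert k T) I).eval (-(y k)⁻¹)
      = -s * (numIn s y T I).eval (-(y k)⁻¹) := by
    rw [numIn, eval_quadProd, Finset.prod_insert hk, if_neg hkI, hu2, mul_assoc s, mul_neg, hu,
      numIn, eval_quadProd]
    ring
  have e4 : (numOut s y (insert k T) (insert k I)).eval (-(y k)⁻¹)
      = s * (numOut s y T I).eval (-(y k)⁻¹) := by
    rw [numOut, eval_quadProd, Finset.prod_insert hk, if_pos (Finset.mem_insert_self _ _), hu2,
      neg_mul, mul_assoc s, mul_neg (y k), hu, numOut, eval_quadProd]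
    have : ∀ i ∈ T, (i ∈ insert k I ↔ i ∈ I) := fun i hi => by simp [hne i hi]
    rw [Finset.prod_congr rfl fun i hi => by rw [if_congr (this i hi) rfl rfl]]
    ring
  have h1 := prod_numerator_out (s := s) hinj hkI h0
  have h2 := prod_numerator_in (s := s) hinj
    (fun h => hk (Finset.mem_sdiff.1 h).1 : k ∉ T \ I) h0
  have h3 : ∀ V : Finset ι, ∏ i ∈ V, (1 - s * y i * -(y k)⁻¹ - y i ^ 2 * (-(y k)⁻¹) ^ 2)
      = ∏ i ∈ V, (1 + s * y i * (y k)⁻¹ - y i ^ 2 * (y k)⁻¹ ^ 2) := fun V =>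
    Finset.prod_congr rfl fun i _ => by ring
  have h4 : ∀ V : Finset ι, ∏ i ∈ V, (1 + s * y i * -(y k)⁻¹ - y i ^ 2 * (-(y k)⁻¹) ^ 2)
      = ∏ i ∈ V, (1 - s * y i * (y k)⁻¹ - y i ^ 2 * (y k)⁻¹ ^ 2) := fun V =>
    Finset.prod_congr rfl fun i _ => by ring
  rw [e1, e2, e3, e4, eval_numOut hI, eval_numIn hI, h3, h4, neg_sq, ← Finset.prod_sdiff hI,
    ← Finset.prod_sdiff hI, h1, h2]
  ring

lemma eq_zero_of_eval_inv (hy : ∀ i, y i ≠ 0) (hinj : ∀ i j, i ≠ j → y i ^ 2 ≠ y j ^ 2)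
    {p : Polynomial ℂ} {T : Finset ι} (hdeg : p.natDegree ≤ 2 * #T) (h0 : p.eval 0 = 0)
    (hpos : ∀ k ∈ T, p.eval (y k)⁻¹ = 0) (hneg : ∀ k ∈ T, p.eval (-(y k)⁻¹) = 0) : p = 0 := by
  let r : Option (T ⊕ T) → ℂ := fun o =>
    o.elim 0 (Sum.elim (fun k => (y k)⁻¹) (fun k => -(y k)⁻¹))
  have key : ∀ i j : T, y i ^ 2 = y j ^ 2 → i = j := fun i j h => by
    by_contra hij
    exact hinj i j (fun h' => hij (Subtype.ext h')) h
  have hself : ∀ i j : T, (y i)⁻¹ ≠ -(y j)⁻¹ := fun i j h => by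
    have h' : y i = -y j := by rw [← inv_inj, h, inv_neg]
    obtain rfl := key i j (by rw [h', neg_sq])
    exact hy i (by linear_combination h' / 2)
  refine Polynomial.eq_zero_of_natDegree_lt_card_of_eval_eq_zero p (f := r) ?_ ?_ ?_
  · rintro (_ | i | i) (_ | j | j) h <;> simp only [r, Option.elim, Sum.elim_inl, Sum.elim_inr] at h
    · rfl
    · exact absurd h.symm (inv_ne_zero (hy _))
    · exact absurd h.symm (neg_ne_zero.2 (inv_ne_zero (hy _)))
    · exact absurd h (inv_ne_zero (hy _))
    · rw [key i j (by rw [inv_inj.1 h])]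
    · exact absurd h (hself i j)
    · exact absurd h (neg_ne_zero.2 (inv_ne_zero (hy _)))
    · exact absurd h.symm (hself j i)
    · rw [key i j (by rw [inv_inj.1 (neg_inj.1 h)])]
  · rintro (_ | i | i)
    exacts [h0, hpos i i.2, hneg i i.2]
  · simp only [Fintype.card_option, Fintype.card_sum, Fintype.card_coe]
    omega

lemma exists_insert_eq {T : Finset ι} {k : ι} (hk : k ∈ T) : ∃ T', k ∉ T' ∧ insert k T' = T :=
  ⟨T.erase k, Finset.notMem_erase _ _, Finset.insert_erase hk⟩

lemma sum_signedProd_insert_eq_zero (hinj : ∀ i j, i ≠ j → y i ^ 2 ≠ y j ^ 2) {T : Finset ι}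
    {a : ι} (ha : a ∉ T) (h0 : y a ≠ 0) (w : Finset ι → ℂ)
    (h : ∑ I ∈ T.powerset, signedProd s y T I *
      (w I * (numOut s y T I).eval (y a)⁻¹
        - w (insert a I) * (numIn s y T I).eval (y a)⁻¹) = 0) :
    ∑ I ∈ (insert a T).powerset, signedProd s y (insert a T) I * w I = 0 := by
  rw [← prod_mul_sum_signedProd_insert hinj ha h0] at h
  refine (mul_eq_zero.1 h).resolve_left (Finset.prod_ne_zero_iff.2 fun i hi h' => ?_)
  refine hinj i a (fun e => ha (e ▸ hi)) ?_
  field_simp at h'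
  linear_combination -h'

lemma natDegree_numOut_le (T I : Finset ι) : (numOut s y T I).natDegree ≤ 2 * #T :=
  natDegree_quadProd_le _ _ _

lemma natDegree_numIn_le (T I : Finset ι) : (numIn s y T I).natDegree ≤ 2 * #T :=
  natDegree_quadProd_le _ _ _

lemma eval_zero_numOut (T I : Finset ι) : (numOut s y T I).eval 0 = 1 := by
  rw [← Polynomial.coeff_zero_eq_eval_zero, numOut, coeff_zero_quadProd]

lemma eval_zero_numIn (T I : Finset ι) : (numIn s y T I).eval 0 = 1 := by
  rw [← Polynomial.coeff_zero_eq_eval_zero, numIn, coeff_zero_quadProd]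

open Polynomial in
/-- The polynomial whose value at `y_a⁻¹` is, up to the common denominator, a weighted sum over
subsets of `insert a T`. -/
noncomputable def weightedPoly (s : ℂ) (y : ι → ℂ) (T : Finset ι) (w₀ w₁ : Finset ι → ℂ) :
    Polynomial ℂ :=
  ∑ I ∈ T.powerset, C (signedProd s y T I) *
    (C (w₀ I) * numOut s y T I - C (w₁ I) * numIn s y T I)

lemma eval_weightedPoly (T : Finset ι) (w₀ w₁ : Finset ι → ℂ) (u : ℂ) :
    (weightedPoly s y T w₀ w₁).eval u = ∑ I ∈ T.powerset, signedProd s y T I *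
      (w₀ I * (numOut s y T I).eval u - w₁ I * (numIn s y T I).eval u) := by
  simp [weightedPoly, Polynomial.eval_finsetSum]

lemma coeff_weightedPoly (T : Finset ι) (w₀ w₁ : Finset ι → ℂ) (n : ℕ) :
    (weightedPoly s y T w₀ w₁).coeff n = ∑ I ∈ T.powerset, signedProd s y T I *
      (w₀ I * (numOut s y T I).coeff n - w₁ I * (numIn s y T I).coeff n) := by
  simp [weightedPoly, Polynomial.finsetSum_coeff]

lemma natDegree_weightedPoly_le (T : Finset ι) (w₀ w₁ : Finset ι → ℂ) :
    (weightedPoly s y T w₀ w₁).natDegree ≤ 2 * #T := by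
  refine Polynomial.natDegree_sum_le_of_forall_le _ _ fun I _ => ?_
  refine (Polynomial.natDegree_C_mul_le _ _).trans ?_
  refine (Polynomial.natDegree_sub_le _ _).trans (max_le ?_ ?_)
  · exact (Polynomial.natDegree_C_mul_le _ _).trans (natDegree_numOut_le _ _)
  · exact (Polynomial.natDegree_C_mul_le _ _).trans (natDegree_numIn_le _ _)

lemma weightedPoly_one_eq_zero (hy : ∀ i, y i ≠ 0)
    (hinj : ∀ i j, i ≠ j → y i ^ 2 ≠ y j ^ 2) (T : Finset ι) : weightedPoly s y T 1 1 = 0 := by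
  induction T using Finset.strongInduction with
  | H T ih =>
    refine eq_zero_of_eval_inv hy hinj (natDegree_weightedPoly_le T _ _) ?_ ?_ ?_
    · simp [eval_weightedPoly, eval_zero_numOut, eval_zero_numIn]
    · intro k hkT
      obtain ⟨T, hk, rfl⟩ := exists_insert_eq hkT
      rw [eval_weightedPoly]
      exact eval_inv_eq_zero hinj hk (hy k) _ _ fun _ _ => rfl
    · intro k hkT
      obtain ⟨T, hk, rfl⟩ := exists_insert_eq hkT
      rw [eval_weightedPoly, eval_neg_inv hinj hk (hy k)]
      rcases T.eq_empty_or_nonempty with rfl | ⟨a, haS⟩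
      · simp
      obtain ⟨T, ha, rfl⟩ := exists_insert_eq haS
      have hT : weightedPoly s y T 1 1 = 0 := ih T <|
        (Finset.ssubset_insert ha).trans (Finset.ssubset_insert hk)
      have h := sum_signedProd_insert_eq_zero (s := s) hinj ha (hy a) 1 <| by
        simpa [eval_weightedPoly] using congrArg (Polynomial.eval (y a)⁻¹) hT
      simp only [Pi.one_apply] at h ⊢
      rw [h]
      ring

lemma sum_signedProd_eq_zero (hy : ∀ i, y i ≠ 0)
    (hinj : ∀ i j, i ≠ j → y i ^ 2 ≠ y j ^ 2) {S : Finset ι} (hS : S.Nonempty) :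
    ∑ I ∈ S.powerset, signedProd s y S I = 0 := by
  obtain ⟨a, haS⟩ := hS
  obtain ⟨T, ha, rfl⟩ := exists_insert_eq haS
  simpa using sum_signedProd_insert_eq_zero (s := s) hinj ha (hy a) 1 <| by
    simpa [eval_weightedPoly] using
      congrArg (Polynomial.eval (y a)⁻¹) (weightedPoly_one_eq_zero (s := s) hy hinj T)

lemma sum_signedProd_mul_card_eq_zero (hy : ∀ i, y i ≠ 0)
    (hinj : ∀ i j, i ≠ j → y i ^ 2 ≠ y j ^ 2) (S : Finset ι) (hS : Even #S) :
    ∑ I ∈ S.powerset, signedProd s y S I * (2 * (#I : ℂ) - #S) = 0 := by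
  induction S using Finset.strongInduction with
  | H S ih =>
    rcases S.eq_empty_or_nonempty with rfl | ⟨a, haS⟩
    · simp
    obtain ⟨T, ha, rfl⟩ := exists_insert_eq haS
    have hcard : #(insert a T) = #T + 1 := Finset.card_insert_of_notMem ha
    have hT : T.Nonempty := by
      rw [Finset.nonempty_iff_ne_empty]
      rintro rfl
      simp at hS
    have hP : weightedPoly s y T (fun I => 2 * (#I : ℂ) - (#T + 1))
        (fun I => 2 * ((#I : ℂ) + 1) - (#T + 1)) = 0 := by
      refine eq_zero_of_eval_inv hy hinj (natDegree_weightedPoly_le T _ _) ?_ ?_ ?_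
      · rw [eval_weightedPoly]
        have h := sum_signedProd_eq_zero (s := s) hy hinj hT
        refine Eq.trans ?_ (mul_eq_zero_of_right (-2 : ℂ) h)
        rw [Finset.mul_sum]
        refine Finset.sum_congr rfl fun I _ => ?_
        rw [eval_zero_numOut, eval_zero_numIn]
        ring
      · intro k hkT
        obtain ⟨T, hk, rfl⟩ := exists_insert_eq hkT
        rw [eval_weightedPoly]
        refine eval_inv_eq_zero hinj hk (hy k) _ _ fun I hI => ?_
        rw [Finset.card_insert_of_notMem fun h => hk (hI h)]
        push_cast
        ring
      · intro k hkT
        obtain ⟨T, hk, rfl⟩ := exists_insert_eq hkT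
        have hcard' : #(insert k T) = #T + 1 := Finset.card_insert_of_notMem hk
        have h := ih T ((Finset.ssubset_insert hk).trans (Finset.ssubset_insert ha)) (by
          rw [hcard, hcard'] at hS
          simpa [Nat.even_add_one] using hS)
        rw [eval_weightedPoly, eval_neg_inv hinj hk (hy k)]
        have e1 : ∑ I ∈ T.powerset, signedProd s y T I *
            (2 * ((#I : ℂ) + 1) - (#(insert k T) + 1)) = 0 := by
          rw [← h]
          refine Finset.sum_congr rfl fun I _ => ?_
          rw [hcard']
          push_cast
          ring
        have e2 : ∑ I ∈ T.powerset, signedProd s y T I *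
            (2 * (#(insert k I) : ℂ) - (#(insert k T) + 1)) = 0 := by
          rw [← e1]
          refine Finset.sum_congr rfl fun I hI => ?_
          rw [Finset.card_insert_of_notMem fun h => hk (Finset.mem_powerset.1 hI h)]
          push_cast
          ring
        rw [e1, e2]
        ring
    refine sum_signedProd_insert_eq_zero hinj ha (hy a) _ ?_
    have h := congrArg (Polynomial.eval (y a)⁻¹) hP
    rw [eval_weightedPoly, Polynomial.eval_zero] at h
    rw [← h]
    refine Finset.sum_congr rfl fun I hI => ?_
    rw [Finset.card_insert_of_notMem fun h => ha (Finset.mem_powerset.1 hI h), hcard]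
    push_cast
    ring

lemma sum_signedProd_mul_sq (hy : ∀ i, y i ≠ 0)
    (hinj : ∀ i j, i ≠ j → y i ^ 2 ≠ y j ^ 2) (hs : s ≠ 0) (S : Finset ι) :
    ∑ I ∈ S.powerset, signedProd s y S I * (∑ i ∈ I, y i ^ 2 - ∑ i ∈ S \ I, y i ^ 2)
      = (∑ i ∈ S, y i) * ∑ I ∈ S.powerset, signedProd s y S I *
          (∑ i ∈ I, y i - ∑ i ∈ S \ I, y i) := by
  have h := congrArg (fun p => Polynomial.coeff p 2) (weightedPoly_one_eq_zero (s := s) hy hinj S)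
  simp only [coeff_weightedPoly, Polynomial.coeff_zero, Pi.one_apply, one_mul] at h
  refine mul_left_cancel₀ (pow_ne_zero 2 hs) (sub_eq_zero.1 (Eq.trans ?_ (neg_eq_zero.2
    (mul_eq_zero_of_right 2 h))))
  simp only [Finset.mul_sum, ← Finset.sum_sub_distrib, ← Finset.sum_neg_distrib]
  refine Finset.sum_congr rfl fun I hI => ?_
  have hI := Finset.mem_powerset.1 hI
  have hsum : ∀ g h : ι → ℂ, ∑ i ∈ S, (if i ∈ I then g i else h i)
      = ∑ i ∈ I, g i + ∑ i ∈ S \ I, h i := fun g h => by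
    rw [← Finset.sum_sdiff hI, add_comm]
    congr 1
    · exact Finset.sum_congr rfl fun i hi => if_pos hi
    · exact Finset.sum_congr rfl fun i hi => if_neg (Finset.mem_sdiff.1 hi).2
  have hout := two_mul_coeff_two_quadProd y (fun i => if i ∈ I then -(s * y i) else 0) S
  have hin := two_mul_coeff_two_quadProd y (fun i => if i ∈ I then 0 else s * y i) S
  simp only [Finset.sum_add_distrib, ite_pow, hsum] at hout hin
  simp only [neg_sq, mul_pow, ne_eq, OfNat.ofNat_ne_zero, not_false_eq_true, zero_pow,
    Finset.sum_const_zero, add_zero, zero_add, Finset.sum_neg_distrib,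
    ← Finset.mul_sum] at hout hin
  have hS := Finset.sum_sdiff (f := y) hI
  rw [← numOut] at hout
  rw [← numIn] at hin
  rw [← hS]
  linear_combination signedProd s y S I * (hout - hin)

open Polynomial in
/-- The sum at multiplier `-ω²` in terms of the sum weighted by `S_1(X_-)`. -/
lemma sum_signedProd_mul_zpow (hy : ∀ i, y i ≠ 0)
    (hinj : ∀ i j, i ≠ j → y i ^ 2 ≠ y j ^ 2) {ω : ℂ} (hω : ω ≠ 0) (hs : s = ω - ω⁻¹)
    {S : Finset ι} (hS : S.Nonempty) :
    ∑ I ∈ S.powerset, signedProd s y S I *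
      (s * (∑ i ∈ S, (y i)⁻¹) * ∑ i ∈ I, y i
        + (-1) ^ #S * ω ^ (2 * (#I : ℤ) - #S)) = 0 := by
  induction S using Finset.strongInduction with
  | H S ih =>
    obtain ⟨a, haS⟩ := hS
    obtain ⟨T, ha, rfl⟩ := exists_insert_eq haS
    have hcard : #(insert a T) = #T + 1 := Finset.card_insert_of_notMem ha
    rcases T.eq_empty_or_nonempty with rfl | hT
    · have h := hy a
      rw [Finset.sum_powerset_insert ha]
      simp [signedProd, h, hs]
    have hG : ∑ I ∈ T.powerset, s * (signedProd s y T I *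
        (s * (∑ i ∈ T, (y i)⁻¹) * ∑ i ∈ I, y i + (-1) ^ #T * ω ^ (2 * (#I : ℤ) - #T))) = 0 := by
      rw [← Finset.mul_sum, ih T (Finset.ssubset_insert ha) hT, mul_zero]
    set n := #T with hn
    set R := ∑ i ∈ T, (y i)⁻¹ with hR
    have hL := sum_signedProd_eq_zero (s := s) hy hinj hT
    set K := weightedPoly s y T 0 (-1) with hK
    have hK0 : K.coeff 0 = 0 := by
      simpa [hK, coeff_weightedPoly, numIn, coeff_zero_quadProd] using hL
    have hK1 : K.divX.eval 0 = -s * ∑ I ∈ T.powerset, signedProd s y T I * ∑ i ∈ I, y i := by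
      rw [← Polynomial.coeff_zero_eq_eval_zero, Polynomial.coeff_divX, hK, coeff_weightedPoly,
        Finset.mul_sum]
      have h := mul_eq_zero_of_right (s * ∑ i ∈ T, y i) hL
      rw [← sub_eq_zero, ← h, Finset.mul_sum, ← Finset.sum_sub_distrib]
      refine Finset.sum_congr rfl fun I hI => ?_
      have hI := Finset.mem_powerset.1 hI
      have h1 : (numIn s y T I).coeff 1 = s * ∑ i ∈ T \ I, y i := by
        rw [numIn, coeff_one_quadProd, ← Finset.sum_sdiff hI, Finset.mul_sum,
          Finset.sum_congr rfl fun i hi => if_neg (Finset.mem_sdiff.1 hi).2,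
          Finset.sum_eq_zero (s := I) fun i hi => if_pos hi, add_zero]
      rw [zero_add, h1, ← Finset.sum_sdiff hI]
      simp only [Pi.zero_apply, Pi.neg_apply, Pi.one_apply]
      ring
    have hKu : ∀ u ≠ 0, K.divX.eval u = u⁻¹ * K.eval u := fun u hu => by
      have h := congrArg (Polynomial.eval u) (Polynomial.divX_mul_X_add K)
      rw [hK0, map_zero, add_zero, Polynomial.eval_mul, Polynomial.eval_X] at h
      rw [← h]
      field_simp
    set D := weightedPoly s y T (fun I => ∑ i ∈ I, y i) (fun I => ∑ i ∈ I, y i) with hD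
    have hDdeg : D.natDegree ≤ 2 * n - 1 := by
      refine Polynomial.natDegree_le_pred (natDegree_weightedPoly_le _ _ _) ?_
      simp [hD, coeff_weightedPoly, numIn, numOut, hn, coeff_quadProd_top]
    have hKdeg : K.divX.natDegree ≤ 2 * n - 1 := by
      rw [Polynomial.natDegree_divX_eq_natDegree_tsub_one]
      exact Nat.sub_le_sub_right (natDegree_weightedPoly_le _ _ _) 1
    set W := weightedPoly s y T (fun I => ω ^ (2 * (#I : ℤ) - (n + 1)))
      (fun I => ω ^ (2 * ((#I : ℤ) + 1) - (n + 1))) with hW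
    set E := C s * (C R + X) * (D - K.divX) - C ((-1) ^ n) * W with hE
    have hEu : ∀ u ≠ 0, E.eval u = ∑ I ∈ T.powerset, signedProd s y T I *
        ((s * (R + u) * ∑ i ∈ I, y i - (-1) ^ n * ω ^ (2 * (#I : ℤ) - (n + 1))) *
            (numOut s y T I).eval u -
          (s * (R + u) * (∑ i ∈ I, y i + u⁻¹) - (-1) ^ n * ω ^ (2 * ((#I : ℤ) + 1) - (n + 1))) *
            (numIn s y T I).eval u) := fun u hu => by
      simp only [hE, Polynomial.eval_sub, Polynomial.eval_mul, Polynomial.eval_add,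
        Polynomial.eval_C, Polynomial.eval_X]
      rw [hKu u hu, hD, hK, hW, eval_weightedPoly, eval_weightedPoly, eval_weightedPoly,
        Finset.mul_sum _ _ u⁻¹, ← Finset.sum_sub_distrib, Finset.mul_sum _ _ (s * (R + u)),
        Finset.mul_sum _ _ ((-1) ^ n), ← Finset.sum_sub_distrib]
      refine Finset.sum_congr rfl fun I _ => ?_
      simp only [Pi.zero_apply, Pi.neg_apply, Pi.one_apply]
      ring
    have hE0 : E = 0 := by
      refine eq_zero_of_eval_inv hy hinj (T := T) ?_ ?_ ?_ ?_
      · have hpos : 0 < n := Finset.card_pos.2 hT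
        refine (Polynomial.natDegree_sub_le _ _).trans (max_le ?_ ?_)
        · refine Polynomial.natDegree_mul_le.trans ?_
          have h1 : (C s * (C R + X)).natDegree ≤ 1 := by compute_degree
          have h2 : (D - K.divX).natDegree ≤ 2 * n - 1 :=
            (Polynomial.natDegree_sub_le _ _).trans (max_le hDdeg hKdeg)
          omega
        · exact (Polynomial.natDegree_C_mul_le _ _).trans (natDegree_weightedPoly_le _ _ _)
      · simp only [hE, Polynomial.eval_sub, Polynomial.eval_mul, Polynomial.eval_add,
          Polynomial.eval_C, Polynomial.eval_X, hK1, hD, hW, eval_weightedPoly, eval_zero_numIn,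
          eval_zero_numOut]
        refine Eq.trans ?_ hG
        simp only [sub_self, mul_zero, Finset.sum_const_zero, zero_sub, mul_one, add_zero, neg_mul,
          neg_neg]
        rw [Finset.mul_sum _ _ ((-1 : ℂ) ^ n), Finset.mul_sum T.powerset _ s,
          Finset.mul_sum T.powerset _ (s * R), ← Finset.sum_sub_distrib]
        refine Finset.sum_congr rfl fun I _ => ?_
        rw [show 2 * (#I : ℤ) - (n + 1) = 2 * (#I : ℤ) - n - 1 by ring,
          show 2 * ((#I : ℤ) + 1) - (n + 1) = 2 * (#I : ℤ) - n + 1 by ring,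
          zpow_sub_one₀ hω, zpow_add_one₀ hω]
        linear_combination (signedProd s y T I * (-1) ^ n * ω ^ (2 * (#I : ℤ) - n)) * -hs
      · intro k hkT
        obtain ⟨T, hk, rfl⟩ := exists_insert_eq hkT
        rw [hEu _ (inv_ne_zero (hy k))]
        refine eval_inv_eq_zero hinj hk (hy k) _ _ fun I hI => ?_
        have hkI : k ∉ I := fun h => hk (hI h)
        rw [Finset.card_insert_of_notMem hkI, Finset.sum_insert hkI, inv_inv]
        push_cast
        ring
      · intro k hkT
        obtain ⟨T, hk, rfl⟩ := exists_insert_eq hkT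
        have hn' : n = #T + 1 := Finset.card_insert_of_notMem hk
        have hRk : R + -(y k)⁻¹ = ∑ i ∈ T, (y i)⁻¹ := by
          rw [hR, Finset.sum_insert hk]
          ring
        rw [hEu _ (neg_ne_zero.2 (inv_ne_zero (hy k))), hRk, eval_neg_inv hinj hk (hy k)]
        rcases T.eq_empty_or_nonempty with rfl | hT'
        · simp
        have hL' := sum_signedProd_eq_zero (s := s) hy hinj hT'
        have hG' := ih T ((Finset.ssubset_insert hk).trans (Finset.ssubset_insert ha)) hT'
        have hexp : ∀ c : ℤ, 2 * (c + 1) - ((n : ℤ) + 1) = 2 * c - #T := fun c => by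
          rw [hn']
          push_cast
          ring
        have shift : ∀ z : ℂ, ∑ I ∈ T.powerset, signedProd s y T I *
            (s * (∑ i ∈ T, (y i)⁻¹) * (∑ i ∈ I, y i + z)
              - (-1) ^ n * ω ^ (2 * ((#I : ℤ) + 1) - (n + 1))) = 0 := fun z => by
          have h := congrArg₂ (· + ·) hG'
            (mul_eq_zero_of_right (s * (∑ i ∈ T, (y i)⁻¹) * z) hL')
          simp only [add_zero, Finset.mul_sum _ _ (s * (∑ i ∈ T, (y i)⁻¹) * z),
            ← Finset.sum_add_distrib] at h
          rw [← h]
          refine Finset.sum_congr rfl fun I _ => ?_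
          rw [hexp, hn', pow_succ]
          ring
        have shift' : ∑ I ∈ T.powerset, signedProd s y T I *
            (s * (∑ i ∈ T, (y i)⁻¹) * (∑ i ∈ insert k I, y i)
              - (-1) ^ n * ω ^ (2 * (#(insert k I) : ℤ) - (n + 1))) = 0 := by
          rw [← shift (y k)]
          refine Finset.sum_congr rfl fun I hI => ?_
          have hkI : k ∉ I := fun h => hk (Finset.mem_powerset.1 hI h)
          rw [Finset.card_insert_of_notMem hkI, Finset.sum_insert hkI]
          push_cast
          ring
        rw [shift, shift']
        ring
    refine sum_signedProd_insert_eq_zero hinj ha (hy a) _ ?_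
    have h := hEu _ (inv_ne_zero (hy a))
    rw [hE0, Polynomial.eval_zero] at h
    rw [h]
    refine Finset.sum_congr rfl fun I hI => ?_
    have haI : a ∉ I := fun h => ha (Finset.mem_powerset.1 hI h)
    rw [Finset.card_insert_of_notMem haI, Finset.sum_insert ha, Finset.sum_insert haI, hcard,
      inv_inv]
    push_cast
    ring

end PowersetSums

lemma ff_div {ω x z : ℂ} (hω : ω ≠ 0) (hz : z ≠ 0) (h : x ^ 2 ≠ z ^ 2) :
    ff ω (x / z) = pairFactor (ω - ω⁻¹) x z := by
  have h1 := sub_ne_zero.2 h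
  have h2 : (x / z) ^ 2 - 1 ≠ 0 := by
    rw [div_pow, div_sub_one (pow_ne_zero 2 hz)]
    exact div_ne_zero h1 (pow_ne_zero 2 hz)
  rw [ff, pairFactor, div_eq_div_iff h2 h1]
  field_simp
  ring

lemma phase_neg_half (N c : ℕ) :
    phase (-(1 / 2)) N c = (-I) ^ (-(N : ℤ)) * (-1) ^ c := by
  have h : Complex.exp (-(Real.pi / 2 * I)) = -I := by
    rw [Complex.exp_neg, Complex.exp_pi_div_two_mul_I, Complex.inv_I]
  have h1 : (-I) ^ (-(N : ℤ)) * (-1) ^ c = (-I) ^ (2 * (c : ℤ) - N) := by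
    rw [sub_eq_add_neg, zpow_add₀ (neg_ne_zero.2 I_ne_zero), zpow_mul, mul_comm]
    simp
  rw [h1, ← h, ← Complex.exp_int_mul, phase]
  congr 1
  push_cast
  ring

lemma hasDerivAt_phase (a : ℂ) (N c : ℕ) :
    HasDerivAt (fun a => phase a N c)
      (phase a N c * (I * Real.pi * (2 * (c : ℂ) - N))) a := by
  have h : HasDerivAt (fun a : ℂ => I * Real.pi * a * (2 * (c : ℂ) - N))
      (I * Real.pi * (2 * (c : ℂ) - N)) a := by
    simpa using ((hasDerivAt_id a).const_mul (I * (Real.pi : ℂ))).mul_const (2 * (c : ℂ) - N)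
  exact h.cexp

lemma deriv_Jexp (ω a : ℂ) {N : ℕ} (X : Fin N → ℂ) :
    deriv (fun a => Jexp ω a X) a = ∑ S : Finset (Fin N),
      phase a N #S * (I * Real.pi * (2 * (#S : ℂ) - N)) *
        ∏ i ∈ S, ∏ j ∈ Sᶜ, ff ω (X i / X j) := by
  refine HasDerivAt.deriv ?_
  unfold Jexp
  exact HasDerivAt.fun_sum fun S _ => (hasDerivAt_phase a N #S).mul_const _

lemma Ph_k2 {N : ℕ} (X : Fin N → ℂ) (Im Ip : Finset (Fin N)) :
    Ph k2 2 X Im Ip = ∑ i ∈ Im, X i ^ 2 - ∑ i ∈ Ip, X i ^ 2 := by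
  have h : Finset.Icc 1 2 = {1, 2} := by decide
  simp [Ph, h, k2, pS]

/-- energy-momentum conservation identity for the form factors: for even
`N ≥ 2` and admissible `X`,
`S_{−1}(X)·(J^{(2)}_{N,−1/2}(X) + (i/π)·S_1(X)²·(d/da J_{N,a}(X))|_{a=−1/2})
  = (i/sin πp)·S_1(X)·J̃_N(X)`, with `sin πp = (ω − ω⁻¹)/(2i)`. -/
theorem stmt17 (ω : ℂ) (hω : ω ≠ 0 ∧ ω ≠ 1 ∧ ω ≠ -1)
    (N : ℕ) (hN : Even N) (hN2 : 2 ≤ N) (X : Fin N → ℂ) (hadm : Admissible X) :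
    (∑ i : Fin N, (X i)⁻¹) *
      (J ω k2 2 (-(1 / 2 : ℂ)) X +
        (Complex.I / (Real.pi : ℂ)) * (∑ i : Fin N, X i) ^ 2 *
          deriv (fun a : ℂ => Jexp ω a X) (-(1 / 2 : ℂ)))
    = (Complex.I / ((ω - ω⁻¹) / (2 * Complex.I))) * (∑ i : Fin N, X i) * Jtilde ω X := by
  obtain ⟨hy, hadm⟩ := hadm
  obtain ⟨hω0, hω1, hω2⟩ := hω
  have hinj : ∀ i j, i ≠ j → X i ^ 2 ≠ X j ^ 2 := fun i j hij h =>
    (sq_eq_sq_iff_eq_or_eq_neg.1 h).elim (hadm i j hij).1 (hadm i j hij).2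
  have hne : (Finset.univ : Finset (Fin N)).Nonempty := ⟨⟨0, by omega⟩, Finset.mem_univ _⟩
  set s := ω - ω⁻¹ with hs
  have hs0 : s ≠ 0 := fun h => by
    have h' : (ω - 1) * (ω + 1) = 0 := by
      linear_combination ω * (hs.symm.trans h) + mul_inv_cancel₀ hω0
    rcases mul_eq_zero.1 h' with h' | h'
    · exact hω1 (sub_eq_zero.1 h')
    · exact hω2 (eq_neg_of_add_eq_zero_left h')
  set c := (-I) ^ (-(N : ℤ)) with hc
  have hF : ∀ S : Finset (Fin N), (-1) ^ #S * ∏ i ∈ S, ∏ j ∈ Sᶜ, ff ω (X i / X j)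
      = signedProd s X Finset.univ S := fun S => by
    rw [signedProd, ← Finset.compl_eq_univ_sdiff]
    congr 1
    refine Finset.prod_congr rfl fun i hi => Finset.prod_congr rfl fun j hj => ?_
    exact ff_div hω0 (hy j) (hinj i j fun h => Finset.mem_compl.1 hj (h ▸ hi))
  have hL := sum_signedProd_eq_zero (s := s) hy hinj hne
  have hM := sum_signedProd_mul_card_eq_zero (s := s) hy hinj Finset.univ (by simpa using hN)
  have hQ := sum_signedProd_mul_sq hy hinj hs0 Finset.univ
  have hG := sum_signedProd_mul_zpow hy hinj hω0 hs hne
  simp only [Finset.powerset_univ, Finset.card_univ, Fintype.card_fin, hN.neg_one_pow, one_mul,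
    mul_add, Finset.sum_add_distrib] at hL hM hQ hG
  set A := ∑ S, signedProd s X Finset.univ S * ∑ i ∈ S, X i with hA
  set B := ∑ S, signedProd s X Finset.univ S * ω ^ (2 * (#S : ℤ) - N) with hB
  have hG' : s * (∑ i, (X i)⁻¹) * A + B = 0 := by
    rw [← hG, hA, Finset.mul_sum]
    congr 1
    exact Finset.sum_congr rfl fun S _ => by ring
  have hQ' : ∑ S, signedProd s X Finset.univ S * (∑ i ∈ S, X i - ∑ i ∈ Finset.univ \ S, X i)
      = 2 * A := by
    have h := mul_eq_zero_of_right (∑ i, X i) hL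
    rw [← sub_eq_zero, ← neg_eq_zero, ← h, hA, Finset.mul_sum, Finset.mul_sum,
      ← Finset.sum_sub_distrib, ← Finset.sum_neg_distrib]
    refine Finset.sum_congr rfl fun S _ => ?_
    rw [← Finset.sum_sdiff (Finset.subset_univ S)]
    ring
  have hJ : J ω k2 2 (-(1 / 2 : ℂ)) X = c * ((∑ i, X i) * (2 * A)) := by
    rw [← hQ', ← hQ, J, Finset.mul_sum]
    refine Finset.sum_congr rfl fun S _ => ?_
    rw [← hF, phase_neg_half, Ph_k2, ← Finset.compl_eq_univ_sdiff]
    ring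
  have hd : deriv (fun a : ℂ => Jexp ω a X) (-(1 / 2 : ℂ)) = 0 := by
    rw [deriv_Jexp, ← mul_eq_zero_of_right (c * (I * Real.pi)) hM, Finset.mul_sum]
    refine Finset.sum_congr rfl fun S _ => ?_
    rw [← hF, phase_neg_half]
    ring
  have hT : Jtilde ω X = c * B := by
    rw [Jtilde, hB, Finset.mul_sum]
    refine Finset.sum_congr rfl fun S _ => ?_
    rw [← hF, ← neg_mul, mul_zpow, hc, sub_eq_add_neg (2 * (#S : ℤ)),
      zpow_add₀ (neg_ne_zero.2 I_ne_zero), zpow_mul]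
    simp only [zpow_ofNat, neg_sq, I_sq, zpow_natCast]
    ring
  have hI : I / (s / (2 * I)) = -2 / s := by
    field_simp
    rw [I_sq]
  rw [hJ, hd, hT, hI, eq_neg_of_add_eq_zero_right hG']
  clear_value s
  linear_combination -(2 * c * (∑ i, X i) * (∑ i, (X i)⁻¹) * A) * mul_inv_cancel₀ hs0
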